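/- arXiv:0801.0734 — 4 statements merged into one kernel-verified Lean document; each statement's English description precedes it below -/
import Mathlib

section
/- Let M be a symmetric n×n real matrix with M_{ij} ≥ 0 whenever i ≠ j, and suppose M is connected in the sense that for every nonempty proper subset S ⊆ {1, …, n} there exist i ∈ S and j ∉ S with M_{ij} > 0. If x ∈ ℝ^n is nonzero with x_i ≥ 0 for all i and (Mx)_i ≤ 0 for all i, then x_i > 0 for all i. -/
/-- If `M` is a symmetric `n × n` real matrix with nonnegative off-diagonal entries
which is connected (for every nonempty proper subset `S` of the indices there are
`i ∈ S` and `j ∉ S` with `M i j > 0`), then any nonzero antinef vector with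
nonnegative entries has strictly positive entries. -/
theorem antinef_pos (n : ℕ) (M : Matrix (Fin n) (Fin n) ℝ)
    (hsymm : ∀ i j, M i j = M j i)
    (hoff : ∀ i j, i ≠ j → 0 ≤ M i j)
    (hconn : ∀ S : Finset (Fin n), S.Nonempty → S ≠ Finset.univ →
      ∃ i ∈ S, ∃ j, j ∉ S ∧ 0 < M i j)
    (x : Fin n → ℝ) (hx0 : x ≠ 0) (hxnn : ∀ i, 0 ≤ x i)
    (hanti : ∀ i, M.mulVec x i ≤ 0) :
    ∀ i, 0 < x i := by
  intro k
  by_contra hk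
  have hxk : x k = 0 := le_antisymm (not_lt.mp hk) (hxnn k)
  obtain ⟨l, hl⟩ := Function.ne_iff.mp hx0
  obtain ⟨i, hi, j, hj, hij⟩ := hconn (Finset.univ.filter fun i => x i = 0)
    ⟨k, by simp [hxk]⟩
    (fun h => hl (by simpa using h.ge (Finset.mem_univ l)))
  have hxi : x i = 0 := by simpa using hi
  have hxj : x j ≠ 0 := by simpa using hj
  have hpos : 0 < ∑ m, M i m * x m := by
    refine Finset.sum_pos' (fun m _ => ?_)
      ⟨j, Finset.mem_univ j, mul_pos hij ((hxnn j).lt_of_ne' hxj)⟩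
    by_cases hm : i = m
    · simp [← hm, hxi]
    · exact mul_nonneg (hoff i m hm) (hxnn m)
  exact (hanti i).not_gt hpos
end

section
/- Let n > k ≥ 1 be coprime integers. Define the Hirzebruch–Jung remainder sequence by r_0 = n, r_1 = k, and, for i ≥ 1 with r_i > 0, a_i = ⌈r_{i−1}/r_i⌉ and r_{i+1} = a_i·r_i − r_{i−1}; let m ≥ 1 be the index with r_m = 1 and r_{m+1} = 0. Define rationals j_0 = 1, j_1 = (k+1)/n, and j_{i+1} = a_i·j_i − j_{i−1} for 1 ≤ i ≤ m. Then j_{m+1} = 1. -/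
/-- The Hirzebruch–Jung remainder sequence: `r 0 = n`, `r 1 = k`, and as long as
`r (i+1) > 0`, `r (i+2) = ⌈r i / r (i+1)⌉ * r (i+1) - r i` (and `0` afterwards). -/
def hjR (n k : ℤ) : ℕ → ℤ
  | 0 => n
  | 1 => k
  | i + 2 =>
    if 0 < hjR n k (i + 1) then
      ⌈(hjR n k i : ℚ) / (hjR n k (i + 1) : ℚ)⌉ * hjR n k (i + 1) - hjR n k i
    else 0

/-- The Hirzebruch–Jung continued fraction coefficients `a i = ⌈r (i-1) / r i⌉`. -/
def hjA (n k : ℤ) (i : ℕ) : ℤ := ⌈(hjR n k (i - 1) : ℚ) / (hjR n k i : ℚ)⌉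

/-- The candidate jumping number sequence: `j 0 = 1`, `j 1 = (k+1)/n`, and
`j (i+1) = a i * j i - j (i-1)`. -/
def hjJ (n k : ℤ) : ℕ → ℚ
  | 0 => 1
  | 1 => ((k : ℚ) + 1) / (n : ℚ)
  | i + 2 => (hjA n k (i + 1) : ℚ) * hjJ n k (i + 1) - hjJ n k i

theorem hjR_pos_of_succ_pos {n k : ℤ} (hn : 0 < n) {i : ℕ} (h : 0 < hjR n k (i + 1)) :
    0 < hjR n k i := by
  cases i with
  | zero => simpa [hjR] using hn
  | succ i =>
    by_contra hneg
    simp [hjR, hneg] at h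

/-- The determinant `r i * j (i+1) - r (i+1) * j i` keeps its initial value `1` as long as the
remainders stay positive. -/
theorem hjR_mul_hjJ_sub {n k : ℤ} (hn : 0 < n) (i : ℕ) (h : 0 < hjR n k i) :
    (hjR n k i : ℚ) * hjJ n k (i + 1) - hjR n k (i + 1) * hjJ n k i = 1 := by
  induction i with
  | zero =>
    have hn' : (n : ℚ) ≠ 0 := by exact_mod_cast hn.ne'
    simp only [hjR, hjJ]
    field_simp
    ring
  | succ i ih =>
    have hR : hjR n k (i + 2) = hjA n k (i + 1) * hjR n k (i + 1) - hjR n k i := by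
      simp [hjR, hjA, h]
    have hJ : hjJ n k (i + 2) = hjA n k (i + 1) * hjJ n k (i + 1) - hjJ n k i := by
      simp [hjJ]
    rw [hR, hJ]
    push_cast
    linear_combination ih (hjR_pos_of_succ_pos hn h)

/-- For coprime integers `n > k ≥ 1` with Hirzebruch–Jung data terminating at
`r m = 1`, `r (m+1) = 0`, the candidate jumping number sequence closes up with
`j (m+1) = 1`. -/
theorem hj_jumping_closes (n k : ℤ) (hk : 1 ≤ k) (hkn : k < n)
    (hcop : Int.gcd n k = 1) (m : ℕ) (hm : 1 ≤ m)
    (hrm : hjR n k m = 1) (hrm1 : hjR n k (m + 1) = 0) :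
    hjJ n k (m + 1) = 1 := by
  simpa [hrm, hrm1] using hjR_mul_hjJ_sub (n := n) (k := k) (by lia) m (by lia)
end

section
/- Let n > k ≥ 1 be coprime integers. Define the Hirzebruch–Jung remainder sequence by r_0 = n, r_1 = k, and, for i ≥ 1 with r_i > 0, a_i = ⌈r_{i−1}/r_i⌉ and r_{i+1} = a_i·r_i − r_{i−1}; let m ≥ 1 be the index with r_m = 1 and r_{m+1} = 0. Define rationals j_0 = 1, j_1 = (k+1)/n, and j_{i+1} = a_i·j_i − j_{i−1} for 1 ≤ i ≤ m. Then 0 < j_i ≤ 1 for all 0 ≤ i ≤ m+1. -/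
theorem hjR_succ_succ_of_pos {n k : ℤ} {i : ℕ} (h : 0 < hjR n k (i + 1)) :
    hjR n k (i + 2) = hjA n k (i + 1) * hjR n k (i + 1) - hjR n k i := by
  rw [hjR, if_pos h, hjA, Nat.add_sub_cancel]

theorem hjR_nonpos_of_le {n k : ℤ} {i l : ℕ} (h : hjR n k (i + 1) ≤ 0) (hl : i + 1 ≤ l) :
    hjR n k l ≤ 0 := by
  induction l, hl using Nat.le_induction with
  | base => exact h
  | succ l hl ih =>
    obtain ⟨l, rfl⟩ : ∃ p, l = p + 1 := ⟨l - 1, by omega⟩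
    rw [hjR, if_neg (not_lt.mpr ih)]

/-- While the remainders stay positive, they decrease strictly, the sequence `n * j i - r i`
increases by at least one at each step, and the Casoratian of the two sequences is `n`. -/
theorem hjR_hjJ_invariants {n k : ℤ} (hk : 0 ≤ k) (hkn : k < n) (i : ℕ)
    (hpos : ∀ l, l < i → 0 < hjR n k (l + 1)) :
    0 ≤ hjR n k (i + 1) ∧ hjR n k (i + 1) < hjR n k i ∧
      0 ≤ n * hjJ n k i - hjR n k i ∧
      n * hjJ n k i - hjR n k i + 1 ≤ n * hjJ n k (i + 1) - hjR n k (i + 1) ∧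
      hjR n k i * (n * hjJ n k (i + 1) - hjR n k (i + 1)) -
        hjR n k (i + 1) * (n * hjJ n k i - hjR n k i) = n := by
  induction i with
  | zero =>
    have hn : (n : ℚ) ≠ 0 := by
      have : n ≠ 0 := by omega
      exact_mod_cast this
    have h : (n : ℚ) * (((k : ℚ) + 1) / n) = k + 1 := mul_div_cancel₀ _ hn
    simp [hjR, hjJ, h, hk, hkn]
  | succ i ih =>
    obtain ⟨-, hlt, hs, hs', hw⟩ := ih fun l hl => hpos l (by omega)
    have hp := hpos i (by omega)
    have hR := hjR_succ_succ_of_pos hp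
    have hJ : hjJ n k (i + 2) = hjA n k (i + 1) * hjJ n k (i + 1) - hjJ n k i := by rw [hjJ]
    have hpQ : (0 : ℚ) < hjR n k (i + 1) := by exact_mod_cast hp
    have hltQ : (hjR n k (i + 1) : ℚ) < hjR n k i := by exact_mod_cast hlt
    have hA : hjA n k (i + 1) = ⌈(hjR n k i : ℚ) / hjR n k (i + 1)⌉ := by
      rw [hjA, Nat.add_sub_cancel]
    have hle := Int.le_ceil ((hjR n k i : ℚ) / hjR n k (i + 1))
    have hub := Int.ceil_lt_add_one ((hjR n k i : ℚ) / hjR n k (i + 1))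
    have h1 : 1 < hjA n k (i + 1) := by
      rw [hA, Int.lt_ceil, Int.cast_one, one_lt_div hpQ]
      exact hltQ
    rw [← hA, div_le_iff₀ hpQ] at hle
    rw [← hA, ← sub_lt_iff_lt_add, lt_div_iff₀ hpQ] at hub
    have hleZ : hjR n k i ≤ hjA n k (i + 1) * hjR n k (i + 1) := by exact_mod_cast hle
    have hubZ : (hjA n k (i + 1) - 1) * hjR n k (i + 1) < hjR n k i := by exact_mod_cast hub
    have h2 : (2 : ℚ) ≤ hjA n k (i + 1) := by exact_mod_cast h1
    have hRQ : (hjR n k (i + 2) : ℚ) = hjA n k (i + 1) * hjR n k (i + 1) - hjR n k i := by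
      exact_mod_cast hR
    refine ⟨by rw [hR]; linarith, by rw [hR]; linarith, by linarith, ?_, ?_⟩
    · rw [hJ, hRQ]
      nlinarith [mul_nonneg (sub_nonneg.mpr h2) (show 0 ≤ n * hjJ n k (i + 1) -
        (hjR n k (i + 1) : ℚ) by linarith)]
    · rw [hJ, hRQ]
      linear_combination hw

/-- For coprime integers `n > k ≥ 1` with Hirzebruch–Jung data terminating at
`r m = 1`, `r (m+1) = 0`, the candidate jumping numbers satisfy `0 < j i ≤ 1`
for all `0 ≤ i ≤ m + 1`. -/
theorem hj_jumping_bounds (n k : ℤ) (hk : 1 ≤ k) (hkn : k < n)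
    (hcop : Int.gcd n k = 1) (m : ℕ) (hm : 1 ≤ m)
    (hrm : hjR n k m = 1) (hrm1 : hjR n k (m + 1) = 0) :
    ∀ i, i ≤ m + 1 → 0 < hjJ n k i ∧ hjJ n k i ≤ 1 := by
  have hpos : ∀ l, l < m → 0 < hjR n k (l + 1) := by
    intro l hl
    by_contra! h
    have := hjR_nonpos_of_le h (show l + 1 ≤ m by omega)
    omega
  have hn : (0 : ℚ) < n := by
    have : 0 < n := by omega
    exact_mod_cast this
  intro i hi
  rcases Nat.lt_or_ge m i with him | him
  · obtain rfl : i = m + 1 := by omega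
    obtain ⟨-, -, -, -, hw⟩ := hjR_hjJ_invariants (by omega) hkn m hpos
    rw [hrm, hrm1] at hw
    have hj : hjJ n k (m + 1) = 1 := by
      apply mul_left_cancel₀ hn.ne'
      push_cast at hw
      linarith
    rw [hj]
    norm_num
  · obtain ⟨hr, hlt, hs, hs', hw⟩ :=
      hjR_hjJ_invariants (by omega) hkn i fun l hl => hpos l (by omega)
    have hrQ : (0 : ℚ) ≤ hjR n k (i + 1) := by exact_mod_cast hr
    have hltQ : (hjR n k (i + 1) : ℚ) + 1 ≤ hjR n k i := by exact_mod_cast hlt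
    constructor
    · refine pos_of_mul_pos_right (a := (n : ℚ)) ?_ hn.le
      linarith
    · refine le_of_mul_le_mul_left ?_ hn
      nlinarith [mul_le_mul_of_nonneg_left hs' (show (0 : ℚ) ≤ hjR n k i by linarith),
        mul_nonneg (sub_nonneg.mpr hltQ) hs]
end

section
/- Let n > k ≥ 1 be coprime integers. Define the Hirzebruch–Jung remainder sequence by r_0 = n, r_1 = k, and, for i ≥ 1 with r_i > 0, a_i = ⌈r_{i−1}/r_i⌉ and r_{i+1} = a_i·r_i − r_{i−1}; let m ≥ 1 be the index with r_m = 1 and r_{m+1} = 0. Define rationals j_0 = 1, j_1 = (k+1)/n, and j_{i+1} = a_i·j_i − j_{i−1} for 1 ≤ i ≤ m. Let M be the m×m symmetric tridiagonal matrix with M_{ii} = −a_i, M_{ij} = 1 when |i − j| = 1, and M_{ij} = 0 otherwise. Then the vector b ∈ ℚ^m with b_i = j_i − 1 is the unique solution of the linear system Σ_j M_{ij}·b_j = a_i − 2 for all 1 ≤ i ≤ m. -/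
/-- Once the remainder sequence is nonpositive at a positive index, it vanishes afterwards. -/
lemma hjR_eq_zero_of_nonpos (n k : ℤ) {i : ℕ} (h : hjR n k (i + 1) ≤ 0) (d : ℕ) :
    hjR n k (i + 2 + d) = 0 := by
  induction d with
  | zero => simp [hjR, not_lt.mpr h]
  | succ d ih =>
    have h0 : ¬ 0 < hjR n k (i + 1 + d + 1) := by
      rw [show i + 1 + d + 1 = i + 2 + d by omega, ih]
      exact lt_irrefl 0
    rw [show i + 2 + (d + 1) = (i + 1 + d) + 2 by omega, hjR, if_neg h0]

lemma hjR_pos {n k : ℤ} {m i : ℕ} (hrm : hjR n k m = 1) (hi : i + 1 ≤ m) :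
    0 < hjR n k (i + 1) := by
  by_contra! h
  rcases hi.eq_or_lt with rfl | hlt
  · omega
  · have h0 := hjR_eq_zero_of_nonpos n k h (m - (i + 2))
    rw [show i + 2 + (m - (i + 2)) = m by omega] at h0
    omega

lemma hjR_recurrence {n k : ℤ} {m i : ℕ} (hrm : hjR n k m = 1) (hi : i + 1 ≤ m) :
    (hjR n k (i + 2) : ℚ) = hjA n k (i + 1) * hjR n k (i + 1) - hjR n k i := by
  rw [hjR, if_pos (hjR_pos hrm hi), hjA, Nat.add_sub_cancel]
  push_cast
  rfl

/-- The Casoratian of two solutions of `u (i+2) = a (i+1) * u (i+1) - u i` is constant. -/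
lemma casoratian_eq {R : Type*} [CommRing R] {a x r : ℕ → R} {m : ℕ}
    (hx : ∀ i < m, x (i + 2) = a (i + 1) * x (i + 1) - x i)
    (hr : ∀ i < m, r (i + 2) = a (i + 1) * r (i + 1) - r i) {i : ℕ} (hi : i ≤ m) :
    x (i + 1) * r i - x i * r (i + 1) = x 1 * r 0 - x 0 * r 1 := by
  induction i with
  | zero => rfl
  | succ i ih =>
    rw [← ih (by omega), hx i hi, hr i hi]
    ring

lemma hjJ_end {n k : ℤ} (hn : n ≠ 0) {m : ℕ} (hrm : hjR n k m = 1)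
    (hrm1 : hjR n k (m + 1) = 0) : hjJ n k (m + 1) = 1 := by
  have h := casoratian_eq (a := fun i => (hjA n k i : ℚ)) (x := hjJ n k)
    (r := fun i => (hjR n k i : ℚ)) (fun i _ => by rw [hjJ])
    (fun i hi => hjR_recurrence hrm hi) (le_refl m)
  have hn' : (n : ℚ) ≠ 0 := by exact_mod_cast hn
  simp only [hrm, hrm1, hjJ, hjR] at h
  field_simp at h
  push_cast at h
  linarith

/-- A tridiagonal matrix with off-diagonal entries `1`, applied to a vector extended by `0` on
both sides. -/
lemma tridiagonal_mulVec {R : Type*} [CommRing R] (a x : ℕ → R) (m : ℕ) (h0 : x 0 = 0)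
    (hm : x (m + 1) = 0) (p : Fin m) :
    (Matrix.of fun p q : Fin m => if p = q then -a (p.1 + 1)
      else if p.1 + 1 = q.1 ∨ q.1 + 1 = p.1 then 1 else 0).mulVec (fun q => x (q.1 + 1)) p =
      x p.1 + x (p.1 + 2) - a (p.1 + 1) * x (p.1 + 1) := by
  obtain ⟨p, hp⟩ := p
  have split : ∀ q : Fin m,
      (if (⟨p, hp⟩ : Fin m) = q then -a (p + 1)
        else if p + 1 = q.1 ∨ q.1 + 1 = p then 1 else 0) * x (q.1 + 1) =
      (if p = q.1 then -a (p + 1) * x (p + 1) else 0) +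
      (if p + 1 = q.1 then x (p + 2) else 0) + (if q.1 + 1 = p then x p else 0) := by
    rintro ⟨q, hq⟩
    simp only [Fin.mk.injEq]
    rcases lt_trichotomy p q with h | rfl | h
    · by_cases h' : p + 1 = q
      · subst h'
        simp
        omega
      · simp [h.ne, h', show q + 1 ≠ p by omega]
    · simp
    · by_cases h' : q + 1 = p
      · subst h'
        simp
        omega
      · simp [h.ne', h', show p + 1 ≠ q by omega]
  have right : ∑ q : Fin m, (if p + 1 = q.1 then x (p + 2) else 0) = x (p + 2) := by
    rw [Fin.sum_univ_eq_sum_range (fun q => if p + 1 = q then x (p + 2) else 0),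
      Finset.sum_ite_eq]
    split_ifs with h
    · rfl
    · rw [show p + 2 = m + 1 by simp at h; omega, hm]
  have left : ∑ q : Fin m, (if q.1 + 1 = p then x p else 0) = x p := by
    rw [Fin.sum_univ_eq_sum_range (fun q => if q + 1 = p then x p else 0)]
    cases p with
    | zero => simp [h0]
    | succ p => simp [show p < m by omega]
  have diag : ∑ q : Fin m, (if p = q.1 then -a (p + 1) * x (p + 1) else 0) =
      -a (p + 1) * x (p + 1) := by
    rw [Fin.sum_univ_eq_sum_range (fun q => if p = q then -a (p + 1) * x (p + 1) else 0),
      Finset.sum_ite_eq, if_pos (Finset.mem_range.mpr hp)]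
  simp only [Matrix.mulVec, dotProduct, Matrix.of_apply]
  rw [Finset.sum_congr rfl fun q _ => split q, Finset.sum_add_distrib, Finset.sum_add_distrib,
    diag, right, left]
  ring

/-- A solution of the recurrence vanishing at `0` and `m + 1` vanishes in between, provided
another solution is nonzero at `0` and takes the values `1`, `0` at `m`, `m + 1`. -/
lemma eq_zero_of_boundary {R : Type*} [CommRing R] [IsDomain R] {a x r : ℕ → R} {m : ℕ}
    (hx : ∀ i < m, x (i + 2) = a (i + 1) * x (i + 1) - x i)
    (hr : ∀ i < m, r (i + 2) = a (i + 1) * r (i + 1) - r i)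
    (hr0 : r 0 ≠ 0) (hrm : r m = 1) (hrm1 : r (m + 1) = 0)
    (hx0 : x 0 = 0) (hxm : x (m + 1) = 0) {i : ℕ} (hi : i ≤ m) : x i = 0 ∧ x (i + 1) = 0 := by
  induction i with
  | zero =>
    have h := casoratian_eq hx hr (le_refl m)
    simpa [hrm, hrm1, hx0, hxm, hr0] using h
  | succ i ih =>
    obtain ⟨h1, h2⟩ := ih (by omega)
    exact ⟨h2, by rw [hx i hi, h1, h2]; ring⟩

/-- For coprime integers `n > k ≥ 1` with Hirzebruch–Jung data terminating at
`r m = 1`, `r (m+1) = 0`, the vector `b` with `b i = j (i+1) - 1` is the unique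
solution of the adjunction system `(M b) i = a i - 2` for the tridiagonal
intersection matrix `M` with diagonal `-a i`. -/
theorem hj_adjunction_system (n k : ℤ) (hk : 1 ≤ k) (hkn : k < n)
    (hcop : Int.gcd n k = 1) (m : ℕ) (hm : 1 ≤ m)
    (hrm : hjR n k m = 1) (hrm1 : hjR n k (m + 1) = 0) :
    let M : Matrix (Fin m) (Fin m) ℚ := Matrix.of fun p q =>
      if p = q then -(hjA n k (p.1 + 1) : ℚ)
      else if p.1 + 1 = q.1 ∨ q.1 + 1 = p.1 then 1 else 0
    let b : Fin m → ℚ := fun p => hjJ n k (p.1 + 1) - 1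
    (∀ p, M.mulVec b p = (hjA n k (p.1 + 1) : ℚ) - 2) ∧
    (∀ c : Fin m → ℚ, (∀ p, M.mulVec c p = (hjA n k (p.1 + 1) : ℚ) - 2) → c = b) := by
  intro M b
  have hn : n ≠ 0 := by omega
  have hb : ∀ p, M.mulVec b p = (hjA n k (p.1 + 1) : ℚ) - 2 := by
    intro p
    refine (tridiagonal_mulVec (fun i => (hjA n k i : ℚ)) (fun i => hjJ n k i - 1) m
      (by simp [hjJ]) (by simp [hjJ_end hn hrm hrm1]) p).trans ?_
    simp only [hjJ]
    ring
  refine ⟨hb, fun c hc => ?_⟩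
  let x : ℕ → ℚ := fun i =>
    if h : 1 ≤ i ∧ i ≤ m then (c - b) ⟨i - 1, by omega⟩ else 0
  have hx0 : x 0 = 0 := by simp [x]
  have hxm : x (m + 1) = 0 := by simp [x]
  have hxq : (fun q : Fin m => x (q.1 + 1)) = c - b := by
    funext q
    simp [x, Nat.succ_le_of_lt q.2]
  have hx : ∀ i < m, x (i + 2) = hjA n k (i + 1) * x (i + 1) - x i := by
    intro i hi
    have h : M.mulVec (fun q : Fin m => x (q.1 + 1)) ⟨i, hi⟩ = _ :=
      tridiagonal_mulVec (fun i => (hjA n k i : ℚ)) x m hx0 hxm ⟨i, hi⟩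
    rw [hxq, Matrix.mulVec_sub, Pi.sub_apply, hb, hc, sub_self] at h
    simp only at h
    linarith
  funext q
  have hq : x (q.1 + 1) = 0 :=
    (eq_zero_of_boundary (a := fun i => (hjA n k i : ℚ)) (r := fun i => (hjR n k i : ℚ)) hx
      (fun i hi => hjR_recurrence hrm hi) (by simpa [hjR] using hn) (by simp [hrm])
      (by simp [hrm1]) hx0 hxm q.2.le).2
  exact sub_eq_zero.mp ((congrFun hxq q).symm.trans hq)
end
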